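/- arXiv:1703.02636 — 2 statements merged into one kernel-verified Lean document; each statement's English description precedes it below -/
import Mathlib

section
/- Fix A > 0 and p > 1, and for γ ∈ (0,1) and u₀ > 0 let T_b(γ, u₀) denote the blow-up time of the solution of D_c^γ u = A u^p, u(0) = u₀. Then there exist 0 < u₀₁ < u₀₂ (for instance u₀₁ = A^{−1/(p−1)} max(2^{−p/(p−1)}, (p−1)/p^{p/(p−1)}) and u₀₂ = A^{−1/(p−1)} min(1, (1/(p−1))^{1/(p−1)})) such that: if u₀ < u₀₁ then T_b(γ, u₀) → ∞ as γ → 0⁺, while if u₀ > u₀₂ then T_b(γ, u₀) → 0 as γ → 0⁺. -/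
open MeasureTheory Real Filter Set Asymptotics
open scoped ENNReal Topology

/-- `u` is a solution of the Volterra integral form of the fractional ODE
`D_c^γ u = f(u)`, `u(0) = u₀`, on the interval `[0, T)` (with `T ∈ (0,∞]`),
taking values in the set `D`. -/
noncomputable def IsSolUpTo (γ : ℝ) (f : ℝ → ℝ) (D : Set ℝ) (u₀ : ℝ) (u : ℝ → ℝ)
    (T : ℝ≥0∞) : Prop :=
  u 0 = u₀ ∧
  ContinuousOn u {t : ℝ | 0 ≤ t ∧ ENNReal.ofReal t < T} ∧
  (∀ t : ℝ, 0 ≤ t → ENNReal.ofReal t < T → u t ∈ D) ∧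
  (∀ t : ℝ, 0 ≤ t → ENNReal.ofReal t < T →
    u t = u₀ + (1 / Real.Gamma γ) * ∫ s in (0:ℝ)..t, (t - s) ^ (γ - 1) * f (u s))

/-- The maximal existence time `T_b`: the supremum of all `T` such that a solution
exists on `[0, T)`. -/
noncomputable def maxTime (γ : ℝ) (f : ℝ → ℝ) (D : Set ℝ) (u₀ : ℝ) : ℝ≥0∞ :=
  sSup {T : ℝ≥0∞ | ∃ u : ℝ → ℝ, IsSolUpTo γ f D u₀ u T}


lemma aux_limit (T : ℝ) (hT : 0 < T) :
    ∀ᶠ γ : ℝ in 𝓝[>] (0:ℝ), 1/2 ≤ T ^ γ / Real.Gamma (1 + γ) ∧ T ^ γ / Real.Gamma (1 + γ) ≤ 2 := by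
  have h : Tendsto (fun γ : ℝ => T ^ γ / Real.Gamma (1 + γ)) (𝓝 0) (𝓝 (T ^ (0:ℝ) / Real.Gamma (1 + 0))) := by
    apply Tendsto.div
    · exact (Real.continuousAt_const_rpow hT.ne').tendsto
    · have h1 : ContinuousAt Real.Gamma (1 + 0) := by
        apply (Real.differentiableAt_Gamma _).continuousAt
        intro m
        have : (0:ℝ) ≤ m := Nat.cast_nonneg m
        intro h
        linarith
      have h2 : Tendsto (fun γ : ℝ => 1 + γ) (𝓝 0) (𝓝 (1 + 0)) := by
        apply Continuous.tendsto (by fun_prop)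
      exact h1.tendsto.comp h2
    · simp
  simp only [Real.rpow_zero, add_zero, Real.Gamma_one, div_one] at h
  have h' := h.mono_left (nhdsWithin_le_nhds (s := Set.Ioi 0))
  have := h'.eventually (Icc_mem_nhds (a := (1/2:ℝ)) (b := 2) (by norm_num) (by norm_num))
  exact this

lemma kernel_integrable (γ a t : ℝ) (hγ : 0 < γ) :
    IntervalIntegrable (fun s : ℝ => (t - s) ^ (γ - 1)) volume a t := by
  have h := (intervalIntegral.intervalIntegrable_rpow' (a := t - a) (b := 0) (r := γ - 1) (by linarith)).comp_sub_left t
  simpa using h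

lemma kernel_integral (γ a t : ℝ) (hγ : 0 < γ) :
    ∫ s in a..t, (t - s) ^ (γ - 1) = (t - a) ^ γ / γ := by
  have h := intervalIntegral.integral_comp_sub_left (a := a) (b := t) (fun x : ℝ => x ^ (γ - 1)) t
  rw [h, integral_rpow (Or.inl (by linarith))]
  simp [hγ.ne']

lemma rpow_lip (p M : ℝ) (hp : 1 < p) (_hM : 0 ≤ M) (x y : ℝ) (hx : x ∈ Icc 0 M) (hy : y ∈ Icc 0 M) :
    |y ^ p - x ^ p| ≤ p * M ^ (p - 1) * |y - x| := by
  have := Convex.norm_image_sub_le_of_norm_hasDerivWithin_le (f := fun x : ℝ => x ^ p)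
    (f' := fun x => p * x ^ (p - 1)) (s := Icc 0 M) (C := p * M ^ (p - 1)) (x := x) (y := y)
    (fun z hz => (Real.hasDerivAt_rpow_const (Or.inr hp.le)).hasDerivWithinAt) ?_ (convex_Icc 0 M) hx hy
  · simpa [Real.norm_eq_abs] using this
  · intro z hz
    have h0 : 0 ≤ z ^ (p - 1) := Real.rpow_nonneg hz.1 _
    rw [Real.norm_eq_abs, abs_of_nonneg (by positivity)]
    have := Real.rpow_le_rpow hz.1 hz.2 (by linarith : 0 ≤ p - 1)
    gcongr

lemma exists_sol (γ T K B u₀ : ℝ) (g : ℝ → ℝ) (hγ : 0 < γ) (hT : 0 < T) (hK : 0 ≤ K)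
    (hg0 : ∀ x, 0 ≤ g x) (hgB : ∀ x, g x ≤ B) (hgL : ∀ x y, |g x - g y| ≤ K * |x - y|)
    (hC : K * (T ^ γ / Real.Gamma (1 + γ)) ≤ 1/2) :
    ∃ u : ℝ → ℝ, Continuous u ∧ (∀ t, u₀ ≤ u t ∧ u t ≤ u₀ + T ^ γ / Real.Gamma (1 + γ) * B) ∧
      ∀ t, 0 ≤ t → t ≤ T →
        u t = u₀ + (1 / Real.Gamma γ) * ∫ s in (0:ℝ)..t, (t - s) ^ (γ - 1) * g (u s) := by
  have hgc : Continuous g := by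
    have : LipschitzWith ⟨K, hK⟩ g := by
      apply LipschitzWith.of_dist_le_mul
      intro x y
      simp only [Real.dist_eq]
      exact hgL x y
    exact this.continuous
  have hGp : 0 < Real.Gamma γ := Real.Gamma_pos_of_pos hγ
  have hG1 : Real.Gamma (1 + γ) = γ * Real.Gamma γ := by
    rw [add_comm, Real.Gamma_add_one hγ.ne']
  have hB : 0 ≤ B := (hg0 0).trans (hgB 0)
  set w : ℝ → ℝ := fun r => (1 - r) ^ (γ - 1) with hw
  have hwi : IntervalIntegrable w volume 0 1 := kernel_integrable γ 0 1 hγ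
  have hwI : ∫ r in (0:ℝ)..1, w r = 1 / γ := by
    have := kernel_integral γ 0 1 hγ
    simpa using this
  have hwm : Measurable w := by
    simp only [hw]; fun_prop
  have hw0 : ∀ r ∈ Icc (0:ℝ) 1, 0 ≤ w r := fun r hr => Real.rpow_nonneg (by linarith [hr.2]) _
  let J : (ℝ → ℝ) → ℝ → ℝ := fun u τ => ∫ r in (0:ℝ)..1, w r * g (u (τ * r))
  have hInt : ∀ u : ℝ → ℝ, Continuous u → ∀ τ,
      IntervalIntegrable (fun r => w r * g (u (τ * r))) volume 0 1 := by
    intro u hu τ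
    exact hwi.mul_continuousOn (by fun_prop)
  have hJc : ∀ u : ℝ → ℝ, Continuous u → Continuous (J u) := by
    intro u hu
    apply intervalIntegral.continuous_of_dominated_interval (bound := fun r => w r * B)
    · intro τ
      apply Measurable.aestronglyMeasurable
      have : Measurable (fun r => g (u (τ * r))) := by
        apply Continuous.measurable; fun_prop
      exact hwm.mul this
    · intro τ
      apply Eventually.of_forall
      intro r hr
      rw [uIoc_of_le zero_le_one] at hr
      have h1 := hw0 r ⟨hr.1.le, hr.2⟩
      rw [Real.norm_eq_abs, abs_of_nonneg (mul_nonneg h1 (hg0 _))]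
      exact mul_le_mul_of_nonneg_left (hgB _) h1
    · exact hwi.mul_const B
    · apply Eventually.of_forall
      intro r hr
      fun_prop
  have hJ0 : ∀ u : ℝ → ℝ, ∀ τ, 0 ≤ J u τ := by
    intro u τ
    apply intervalIntegral.integral_nonneg zero_le_one
    intro r hr
    exact mul_nonneg (hw0 r hr) (hg0 _)
  have hJB : ∀ u : ℝ → ℝ, Continuous u → ∀ τ, J u τ ≤ B / γ := by
    intro u hu τ
    have : J u τ ≤ ∫ r in (0:ℝ)..1, w r * B := by
      apply intervalIntegral.integral_mono_on zero_le_one (hInt u hu τ) (hwi.mul_const B)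
      intro r hr
      exact mul_le_mul_of_nonneg_left (hgB _) (hw0 r hr)
    rw [intervalIntegral.integral_mul_const, hwI] at this
    calc _ ≤ _ := this
      _ = _ := by ring
  let cl : ℝ → ℝ := fun t => max 0 (min t T)
  have hclc : Continuous cl := by simp only [cl]; fun_prop
  have hcl0 : ∀ t, 0 ≤ cl t := fun t => le_max_left _ _
  have hclT : ∀ t, cl t ≤ T := fun t => max_le hT.le (min_le_right _ _)
  let c : ℝ → ℝ := fun t => (cl t) ^ γ / Real.Gamma γ
  have hc0 : ∀ t, 0 ≤ c t := fun t => div_nonneg (Real.rpow_nonneg (hcl0 t) _) hGp.le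
  have hcT : ∀ t, c t ≤ T ^ γ / Real.Gamma γ := fun t =>
    div_le_div_of_nonneg_right (Real.rpow_le_rpow (hcl0 t) (hclT t) hγ.le) hGp.le
  have hcc : Continuous c := by
    apply Continuous.div_const
    exact hclc.rpow_const (fun _ => Or.inr hγ.le)
  let P : (ℝ → ℝ) → ℝ → ℝ := fun u t => u₀ + c t * J u (cl t)
  have hPc : ∀ u : ℝ → ℝ, Continuous u → Continuous (P u) := by
    intro u hu
    exact continuous_const.add (hcc.mul ((hJc u hu).comp hclc))
  have hPb : ∀ u : ℝ → ℝ, Continuous u → ∀ t, u₀ ≤ P u t ∧ P u t ≤ u₀ + T ^ γ / Real.Gamma (1 + γ) * B := by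
    intro u hu t
    constructor
    · have := mul_nonneg (hc0 t) (hJ0 u (cl t))
      simp only [P]; linarith
    · have := mul_le_mul (hcT t) (hJB u hu (cl t)) (hJ0 _ _) ((hc0 t).trans (hcT t))
      have e : T ^ γ / Real.Gamma γ * (B / γ) = T ^ γ / Real.Gamma (1 + γ) * B := by
        rw [hG1]; field_simp
      simp only [P]; linarith
  have hPn : ∀ u : ℝ → ℝ, Continuous u → ∀ t, ‖P u t‖ ≤ |u₀| + |u₀ + T ^ γ / Real.Gamma (1 + γ) * B| := by
    intro u hu t
    obtain ⟨h1, h2⟩ := hPb u hu t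
    rw [Real.norm_eq_abs, abs_le]
    constructor
    · linarith [neg_abs_le u₀, abs_nonneg (u₀ + T ^ γ / Real.Gamma (1 + γ) * B)]
    · linarith [le_abs_self (u₀ + T ^ γ / Real.Gamma (1 + γ) * B), abs_nonneg u₀]
  let F : BoundedContinuousFunction ℝ ℝ → BoundedContinuousFunction ℝ ℝ := fun u =>
    BoundedContinuousFunction.ofNormedAddCommGroup (P u) (hPc u u.continuous) _ (hPn u u.continuous)
  have hFl : ContractingWith (1/2) F := by
    refine ⟨by rw [← NNReal.coe_lt_coe]; norm_num, ?_⟩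
    apply LipschitzWith.of_dist_le_mul
    intro u v
    rw [BoundedContinuousFunction.dist_le (by positivity)]
    intro t
    change dist (P u t) (P v t) ≤ _
    have hd : |J u (cl t) - J v (cl t)| ≤ K * dist u v / γ := by
      have e : J u (cl t) - J v (cl t) = ∫ r in (0:ℝ)..1, (w r * g (u (cl t * r)) - w r * g (v (cl t * r))) := by
        rw [intervalIntegral.integral_sub (hInt u u.continuous _) (hInt v v.continuous _)]
      rw [e, ← Real.norm_eq_abs]
      have : ‖∫ r in (0:ℝ)..1, (w r * g (u (cl t * r)) - w r * g (v (cl t * r)))‖ ≤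
          ∫ r in (0:ℝ)..1, w r * (K * dist u v) := by
        apply intervalIntegral.norm_integral_le_of_norm_le zero_le_one
        · apply Eventually.of_forall
          intro r hr
          have h1 := hw0 r ⟨hr.1.le, hr.2⟩
          rw [← mul_sub, norm_mul, Real.norm_eq_abs, Real.norm_eq_abs, abs_of_nonneg h1]
          apply mul_le_mul_of_nonneg_left _ h1
          refine (hgL _ _).trans ?_
          apply mul_le_mul_of_nonneg_left _ hK
          rw [← Real.dist_eq]
          exact BoundedContinuousFunction.dist_coe_le_dist _
        · exact hwi.mul_const _
      rw [intervalIntegral.integral_mul_const, hwI] at this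
      calc _ ≤ _ := this
        _ = _ := by ring
    rw [Real.dist_eq]
    have e : P u t - P v t = c t * (J u (cl t) - J v (cl t)) := by simp only [P]; ring
    rw [e, abs_mul, abs_of_nonneg (hc0 t)]
    calc c t * |J u (cl t) - J v (cl t)| ≤ T ^ γ / Real.Gamma γ * (K * dist u v / γ) :=
          mul_le_mul (hcT t) hd (abs_nonneg _) ((hc0 t).trans (hcT t))
      _ = K * (T ^ γ / Real.Gamma (1 + γ)) * dist u v := by rw [hG1]; field_simp
      _ ≤ 1/2 * dist u v := mul_le_mul_of_nonneg_right hC dist_nonneg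
      _ = _ := by simp
  set u := ContractingWith.fixedPoint F hFl with hu
  have hfix : F u = u := hFl.fixedPoint_isFixedPt
  have hfx : ∀ t, u t = P u t := fun t => by
    conv_lhs => rw [← hfix]
    rfl
  refine ⟨u, u.continuous, fun t => by rw [hfx t]; exact hPb u u.continuous t, ?_⟩
  intro t ht0 htT
  rw [hfx t]
  have hclt : cl t = t := by simp [cl, ht0, htT]
  simp only [P, c, hclt]
  rcases ht0.eq_or_lt with h0 | h0
  · subst h0
    simp [Real.zero_rpow hγ.ne']
  · have h1 := intervalIntegral.mul_integral_comp_mul_left (a := 0) (b := 1)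
      (f := fun s => (t - s) ^ (γ - 1) * g (u s)) (c := t)
    simp only [mul_zero, mul_one] at h1
    rw [← h1]
    have h2 : ∫ r in (0:ℝ)..1, (t - t * r) ^ (γ - 1) * g (u (t * r)) =
        ∫ r in (0:ℝ)..1, t ^ (γ - 1) * (w r * g (u (t * r))) := by
      apply intervalIntegral.integral_congr
      intro r hr
      rw [uIcc_of_le zero_le_one] at hr
      simp only [hw]
      rw [show t - t * r = t * (1 - r) by ring, Real.mul_rpow h0.le (by linarith [hr.2])]
      ring
    rw [h2, intervalIntegral.integral_const_mul]
    have h3 : t ^ γ = t * t ^ (γ - 1) := by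
      rw [Real.rpow_sub_one h0.ne']; field_simp
    simp only [J]
    rw [h3]; ring

lemma growth (A p γ ε u₀ : ℝ) (u : ℝ → ℝ) (hA : 0 < A) (hp : 1 < p) (hγ : 0 < γ) (hγ1 : γ ≤ 1)
    (hγp : γ ≤ p - 1) (hε : 0 < ε) (hu0 : 0 < u₀) (hbig : 8 ≤ A * u₀ ^ (p - 1))
    (hC : 1/2 ≤ ε ^ γ / Real.Gamma (1 + γ)) (hc : ContinuousOn u (Icc 0 ε))
    (hpos : ∀ t ∈ Icc 0 ε, 0 < u t)
    (heq : ∀ t ∈ Icc 0 ε, u t = u₀ + (1 / Real.Gamma γ) * ∫ s in (0:ℝ)..t, (t - s) ^ (γ - 1) * (A * (u s) ^ p)) :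
    False := by
  have hGp : 0 < Real.Gamma γ := Real.Gamma_pos_of_pos hγ
  have hG1 : Real.Gamma (1 + γ) = γ * Real.Gamma γ := by
    rw [add_comm, Real.Gamma_add_one hγ.ne']
  have hint : ∀ t ∈ Icc 0 ε, IntervalIntegrable (fun s => (t - s) ^ (γ - 1) * (A * (u s) ^ p)) volume 0 t := by
    intro t ht
    apply (kernel_integrable γ 0 t hγ).mul_continuousOn
    apply ContinuousOn.mul continuousOn_const
    apply ContinuousOn.rpow_const
    · apply hc.mono
      rw [uIcc_of_le ht.1]
      exact Icc_subset_Icc le_rfl ht.2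
    · intro x hx; right; linarith
  have step : ∀ a m t : ℝ, 0 ≤ a → a ≤ t → t ≤ ε → 0 ≤ m → (∀ s ∈ Icc a t, m ≤ u s) →
      u₀ + A * m ^ p * ((t - a) ^ γ / Real.Gamma (1 + γ)) ≤ u t := by
    intro a m t ha hat htε hm hlow
    have ht : t ∈ Icc 0 ε := ⟨ha.trans hat, htε⟩
    have hI := hint t ht
    have hnn : ∀ s ∈ Icc 0 t, 0 ≤ (t - s) ^ (γ - 1) * (A * (u s) ^ p) := by
      intro s hs
      have := hpos s ⟨hs.1, hs.2.trans htε⟩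
      have h2 : 0 ≤ (t - s) ^ (γ - 1) := Real.rpow_nonneg (by linarith [hs.2]) _
      positivity
    have hI1 : IntervalIntegrable (fun s => (t - s) ^ (γ - 1) * (A * (u s) ^ p)) volume 0 a :=
      hI.mono_set (by rw [uIcc_of_le ha, uIcc_of_le ht.1]; exact Icc_subset_Icc le_rfl hat)
    have hI2 : IntervalIntegrable (fun s => (t - s) ^ (γ - 1) * (A * (u s) ^ p)) volume a t :=
      hI.mono_set (by rw [uIcc_of_le hat, uIcc_of_le ht.1]; exact Icc_subset_Icc ha le_rfl)
    have hsplit := intervalIntegral.integral_add_adjacent_intervals hI1 hI2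
    have h1 : 0 ≤ ∫ s in (0:ℝ)..a, (t - s) ^ (γ - 1) * (A * (u s) ^ p) :=
      intervalIntegral.integral_nonneg ha (fun s hs => hnn s ⟨hs.1, hs.2.trans hat⟩)
    have h2 : ∫ s in a..t, (t - s) ^ (γ - 1) * (A * m ^ p) ≤ ∫ s in a..t, (t - s) ^ (γ - 1) * (A * (u s) ^ p) := by
      apply intervalIntegral.integral_mono_on hat ((kernel_integrable γ a t hγ).mul_const _) hI2
      intro s hs
      apply mul_le_mul_of_nonneg_left _ (Real.rpow_nonneg (by linarith [hs.2]) _)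
      apply mul_le_mul_of_nonneg_left _ hA.le
      exact Real.rpow_le_rpow hm (hlow s hs) (by linarith)
    rw [intervalIntegral.integral_mul_const, kernel_integral γ a t hγ] at h2
    rw [heq t ht]
    have h3 : (1 / Real.Gamma γ) * ((t - a) ^ γ / γ * (A * m ^ p)) ≤
        (1 / Real.Gamma γ) * ∫ s in (0:ℝ)..t, (t - s) ^ (γ - 1) * (A * (u s) ^ p) := by
      apply mul_le_mul_of_nonneg_left _ (by positivity)
      linarith
    have e : A * m ^ p * ((t - a) ^ γ / Real.Gamma (1 + γ)) = (1 / Real.Gamma γ) * ((t - a) ^ γ / γ * (A * m ^ p)) := by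
      rw [hG1]; field_simp
    linarith
  have main : ∀ k : ℕ, ∀ t, ε * (1 - (1/2) ^ k) ≤ t → t ≤ ε → u₀ * 2 ^ k ≤ u t := by
    intro k
    induction k with
    | zero =>
      intro t h1 h2
      simp at h1
      have := step t 0 t h1 le_rfl h2 le_rfl (fun s hs => (hpos s ⟨h1.trans hs.1, hs.2.trans h2⟩).le)
      rw [Real.zero_rpow (by linarith)] at this
      simpa using this
    | succ k ih =>
      intro t h1 h2
      have hk1 : ((1:ℝ)/2) ^ k ≤ 1 := pow_le_one₀ (by norm_num) (by norm_num)
      have hk0 : (0:ℝ) < (1/2) ^ k := by positivity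
      have ha : 0 ≤ ε * (1 - (1/2) ^ k) := mul_nonneg hε.le (by linarith)
      have hta : ε * (1/2) ^ (k+1) ≤ t - ε * (1 - (1/2) ^ k) := by
        rw [pow_succ] at h1 ⊢
        nlinarith
      have hta0 : 0 ≤ ε * (1/2) ^ (k+1) := by positivity
      have hs := step _ (u₀ * 2 ^ k) t ha (by linarith) h2 (by positivity)
        (fun s hs => ih s hs.1 (hs.2.trans h2))
      have hr : (ε * (1/2) ^ (k+1)) ^ γ ≤ (t - ε * (1 - (1/2) ^ k)) ^ γ :=
        Real.rpow_le_rpow hta0 hta hγ.le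
      -- kernel factor
      set q : ℝ := 2 ^ k with hq
      have hq1 : 1 ≤ q := one_le_pow₀ (by norm_num)
      have e1 : ((1:ℝ)/2) ^ (k+1) = (2 * q)⁻¹ := by
        rw [hq, one_div, inv_pow, pow_succ, mul_comm]
      have e2 : (ε * (1/2) ^ (k+1)) ^ γ = ε ^ γ * ((2:ℝ) ^ γ * q ^ γ)⁻¹ := by
        rw [e1, Real.mul_rpow hε.le (by positivity), Real.inv_rpow (by positivity),
          Real.mul_rpow (by norm_num) (by positivity)]
      have h2γ : (2:ℝ) ^ γ ≤ 2 := by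
        have := Real.rpow_le_rpow_of_exponent_le (x := 2) (by norm_num) hγ1
        simpa using this
      have hqγ : q ^ γ ≤ q ^ (p - 1) := Real.rpow_le_rpow_of_exponent_le hq1 hγp
      have hqγ0 : 0 < q ^ γ := by positivity
      have hqp0 : 0 < q ^ (p - 1) := by positivity
      have hG0 : 0 < Real.Gamma (1 + γ) := Real.Gamma_pos_of_pos (by linarith)
      have hker : 1/2 * (2 * q ^ (p - 1))⁻¹ ≤ (t - ε * (1 - (1/2) ^ k)) ^ γ / Real.Gamma (1 + γ) := by
        calc 1/2 * (2 * q ^ (p - 1))⁻¹ ≤ (ε ^ γ / Real.Gamma (1 + γ)) * ((2:ℝ) ^ γ * q ^ γ)⁻¹ := by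
              apply mul_le_mul hC _ (by positivity) (by positivity)
              apply inv_anti₀ (by positivity)
              gcongr
          _ = (ε * (1/2) ^ (k+1)) ^ γ / Real.Gamma (1 + γ) := by rw [e2]; ring
          _ ≤ _ := div_le_div_of_nonneg_right hr hG0.le
      have e3 : (u₀ * q) ^ p = (u₀ * q) * (u₀ ^ (p - 1) * q ^ (p - 1)) := by
        rw [← Real.mul_rpow hu0.le (by positivity), Real.rpow_sub_one (by positivity)]
        field_simp
      have hfin : u₀ * q * 2 ≤ A * (u₀ * q) ^ p * (1/2 * (2 * q ^ (p - 1))⁻¹) := by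
        have : A * (u₀ * q) ^ p * (1/2 * (2 * q ^ (p - 1))⁻¹) = (u₀ * q) * (A * u₀ ^ (p-1)) / 4 := by
          rw [e3]; field_simp; ring
        rw [this]
        have : 0 < u₀ * q := by positivity
        nlinarith
      have hmul := mul_le_mul_of_nonneg_left hker (show 0 ≤ A * (u₀ * q) ^ p by positivity)
      rw [pow_succ]
      linarith
  obtain ⟨k, hk⟩ := pow_unbounded_of_one_lt (u ε / u₀) (by norm_num : (1:ℝ) < 2)
  have h := main k ε (by
    have : (0:ℝ) < (1/2)^k := by positivity
    nlinarith) le_rfl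
  rw [div_lt_iff₀ hu0] at hk
  linarith

/-- behavior of the blow-up time as the memory gets stronger (γ → 0⁺). -/
theorem stmt13 (A p : ℝ) (hA : 0 < A) (hp : 1 < p) :
    ∃ u₀₁ u₀₂ : ℝ, 0 < u₀₁ ∧ u₀₁ < u₀₂ ∧
      (∀ u₀ : ℝ, 0 < u₀ → u₀ < u₀₁ →
        Tendsto (fun γ : ℝ => maxTime γ (fun x => A * x ^ p) (Set.Ioi 0) u₀)
          (𝓝[>] (0:ℝ)) (𝓝 ⊤)) ∧
      (∀ u₀ : ℝ, u₀₂ < u₀ →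
        Tendsto (fun γ : ℝ => maxTime γ (fun x => A * x ^ p) (Set.Ioi 0) u₀)
          (𝓝[>] (0:ℝ)) (𝓝 0)) := by
  have hp0 : 0 < p - 1 := by linarith
  have hp' : 0 < p := by linarith
  set M : ℝ := (1 / (4 * A * p)) ^ (1 / (p - 1)) with hM
  have hM0 : 0 < M := by positivity
  have hMp : M ^ (p - 1) = 1 / (4 * A * p) := by
    rw [hM, ← Real.rpow_mul (by positivity), one_div_mul_cancel hp0.ne', Real.rpow_one]
  set R : ℝ := (8 / A) ^ (1 / (p - 1)) with hR
  have hR0 : 0 < R := by positivity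
  have hRp : R ^ (p - 1) = 8 / A := by
    rw [hR, ← Real.rpow_mul (by positivity), one_div_mul_cancel hp0.ne', Real.rpow_one]
  refine ⟨M / 2, max M R, by positivity, lt_of_lt_of_le (by linarith) (le_max_left _ _), ?_, ?_⟩
  · intro u₀ hu0 hu1
    rw [ENNReal.tendsto_nhds_top_iff_nat]
    intro n
    have hT : (0:ℝ) < n + 1 := by positivity
    filter_upwards [aux_limit (n + 1) hT, self_mem_nhdsWithin] with γ hγC hγ
    have hγ : 0 < γ := hγ
    let g : ℝ → ℝ := fun x => A * (max 0 (min x M)) ^ p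
    have hclm : ∀ x, max 0 (min x M) ∈ Icc 0 M := fun x =>
      ⟨le_max_left _ _, max_le hM0.le (min_le_right _ _)⟩
    have hMpp : A * M ^ p ≤ M / 4 := by
      have : M ^ p = M * M ^ (p - 1) := by
        rw [Real.rpow_sub_one hM0.ne']; field_simp
      rw [this, hMp]
      have : A * (M * (1 / (4 * A * p))) = M / 4 * (1 / p) := by field_simp
      rw [this]
      apply mul_le_of_le_one_right (by positivity)
      rw [div_le_one hp']; exact hp.le
    obtain ⟨u, huc, hub, hue⟩ := exists_sol γ (n + 1) (1/4) (M / 4) u₀ g hγ hT (by norm_num)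
      (fun x => mul_nonneg hA.le (Real.rpow_nonneg (hclm x).1 _))
      (fun x => (mul_le_mul_of_nonneg_left (Real.rpow_le_rpow (hclm x).1 (hclm x).2 hp'.le) hA.le).trans hMpp)
      (by
        intro x y
        have h := rpow_lip p M hp hM0.le _ _ (hclm y) (hclm x)
        have h2 : |max 0 (min x M) - max 0 (min y M)| ≤ |x - y| := by
          have h3 := abs_max_sub_max_le_max 0 (min x M) 0 (min y M)
          have h4 := abs_min_sub_min_le_max x M y M
          simp at h3 h4
          exact h3.trans h4
        simp only [g]
        rw [← mul_sub, abs_mul, abs_of_pos hA]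
        calc A * |(max 0 (min x M)) ^ p - (max 0 (min y M)) ^ p|
            ≤ A * (p * M ^ (p - 1) * |x - y|) := by
              apply mul_le_mul_of_nonneg_left _ hA.le
              refine h.trans ?_
              gcongr
          _ = 1/4 * |x - y| := by rw [hMp]; field_simp)
      (by linarith [hγC.2])
    have huM : ∀ t, u t ≤ M := by
      intro t
      have h1 := (hub t).2
      have h2 := mul_le_mul_of_nonneg_right hγC.2 (by positivity : 0 ≤ M / 4)
      linarith
    have hgu : ∀ s, g (u s) = A * (u s) ^ p := by
      intro s
      simp only [g]
      rw [min_eq_left (huM s), max_eq_right (hu0.le.trans (hub s).1)]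
    have hsol : IsSolUpTo γ (fun x => A * x ^ p) (Set.Ioi 0) u₀ u (ENNReal.ofReal (n + 1)) := by
      refine ⟨?_, huc.continuousOn, fun t _ _ => lt_of_lt_of_le hu0 (hub t).1, ?_⟩
      · rw [hue 0 le_rfl hT.le]; simp
      · intro t h1 h2
        rw [ENNReal.ofReal_lt_ofReal_iff hT] at h2
        rw [hue t h1 h2.le]
        simp only [hgu]
    refine lt_of_lt_of_le ?_ (le_sSup ⟨u, hsol⟩)
    rw [← ENNReal.ofReal_natCast, ENNReal.ofReal_lt_ofReal_iff hT]
    linarith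
  · intro u₀ hu
    have huR : R < u₀ := lt_of_le_of_lt (le_max_right _ _) hu
    have hu0 : 0 < u₀ := hR0.trans huR
    have hbig : 8 ≤ A * u₀ ^ (p - 1) := by
      have := Real.rpow_le_rpow hR0.le huR.le hp0.le
      rw [hRp, div_le_iff₀ hA] at this
      linarith
    rw [ENNReal.tendsto_nhds_zero]
    intro e he
    obtain ⟨ε, hε0, hεe⟩ := ENNReal.lt_iff_exists_nnreal_btwn.1 he
    have hε : (0:ℝ) < ε := by exact_mod_cast hε0
    filter_upwards [aux_limit ε hε, self_mem_nhdsWithin,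
      mem_nhdsWithin_of_mem_nhds (Iic_mem_nhds (zero_lt_one (α := ℝ))),
      mem_nhdsWithin_of_mem_nhds (Iic_mem_nhds hp0)] with γ hγC hγ hγ1 hγp
    refine le_trans (sSup_le ?_) hεe.le
    rintro T ⟨u, -, h2, h3, h4⟩
    by_contra! hlt
    have hmem : ∀ t ∈ Icc (0:ℝ) ε, ENNReal.ofReal t < T := by
      intro t ht
      refine lt_of_le_of_lt ?_ hlt
      rw [← ENNReal.ofReal_coe_nnreal]
      exact ENNReal.ofReal_le_ofReal ht.2
    exact growth A p γ ε u₀ u hA hp hγ hγ1 hγp hε hu0 hbig hγC.1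
      (h2.mono (fun t ht => ⟨ht.1, hmem t ht⟩))
      (fun t ht => h3 t ht.1 (hmem t ht)) (fun t ht => h4 t ht.1 (hmem t ht))
end

section
/- Let γ ∈ (0,1), A < 0, u₀ > 0, and p ∈ ℝ. Then there exists T_b ∈ (0, ∞] such that D_c^γ u = A u^p, u(0) = u₀, has a unique solution u on [0, T_b) with values in (0, ∞). Moreover 0 < u(t) < u₀ for t ∈ (0, T_b), u is decreasing on (0, T_b), and lim_{t→T_b⁻} u(t) = 0. -/
open MeasureTheory Real Filter Set Asymptotics
open scoped ENNReal Topology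

lemma kint {γ : ℝ} (hγ : 0 < γ) (t a b : ℝ) :
    IntervalIntegrable (fun s => (t - s) ^ (γ - 1)) volume a b := by
  have h := (intervalIntegral.intervalIntegrable_rpow' (a := t - a) (b := t - b)
    (r := γ - 1) (by linarith)).comp_sub_left t
  simpa using h

lemma kgint {γ : ℝ} (hγ : 0 < γ) (t a b : ℝ) {g : ℝ → ℝ} (hg : ContinuousOn g (uIcc a b)) :
    IntervalIntegrable (fun s => (t - s) ^ (γ - 1) * g s) volume a b :=
  (kint hγ t a b).mul_continuousOn hg

lemma kval {γ : ℝ} (hγ : 0 < γ) (t a : ℝ) :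
    ∫ s in a..t, (t - s) ^ (γ - 1) = (t - a) ^ γ / γ := by
  rw [intervalIntegral.integral_comp_sub_left (fun x => x ^ (γ - 1)) t,
    integral_rpow (Or.inl (by linarith))]
  simp [Real.zero_rpow hγ.ne']

lemma kexp {γ : ℝ} (hγ : 0 < γ) {l : ℝ} (hl : 0 < l) {t : ℝ} (ht : 0 ≤ t) :
    ∫ s in (0:ℝ)..t, (t - s) ^ (γ - 1) * Real.exp (-(l * (t - s))) ≤
      (1 / l) ^ γ * Real.Gamma γ := by
  rw [intervalIntegral.integral_comp_sub_left (fun x => x ^ (γ - 1) * Real.exp (-(l * x))) t,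
    ← Real.integral_rpow_mul_exp_neg_mul_Ioi hγ hl, sub_self, sub_zero,
    intervalIntegral.integral_of_le ht]
  apply setIntegral_mono_set
  · have := Real.GammaIntegral_convergent hγ
    by_contra hcon
    have h1 := Real.integral_rpow_mul_exp_neg_mul_Ioi hγ hl
    rw [integral_undef hcon] at h1
    have : 0 < (1 / l) ^ γ * Real.Gamma γ := by
      have := Real.Gamma_pos_of_pos hγ
      positivity
    linarith
  · filter_upwards [ae_restrict_mem measurableSet_Ioi] with x hx
    have : (0:ℝ) < x := hx
    positivity
  · exact (Ioc_subset_Ioi_self).eventuallyLE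

lemma exl {γ : ℝ} (hγ : 0 < γ) (C : ℝ) :
    ∃ l : ℝ, 0 < l ∧ C * ((1 / l) ^ γ * Real.Gamma γ) ≤ 1 / 2 := by
  have h : Tendsto (fun l : ℝ => C * ((1 / l) ^ γ * Real.Gamma γ)) atTop (𝓝 (C * (0 * Real.Gamma γ))) := by
    apply Tendsto.const_mul
    apply Tendsto.mul_const
    have h1 : Tendsto (fun l : ℝ => 1 / l) atTop (𝓝 0) := by
      simpa using tendsto_inv_atTop_zero (𝕜 := ℝ)
    have := h1.rpow_const (p := γ) (Or.inr hγ.le)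
    rwa [Real.zero_rpow hγ.ne'] at this
  have h2 : ∀ᶠ l : ℝ in atTop, C * ((1 / l) ^ γ * Real.Gamma γ) < 1 / 2 :=
    h.eventually_lt_const (by norm_num)
  obtain ⟨l, h3, h4⟩ := (h2.and (eventually_gt_atTop 0)).exists
  exact ⟨l, h4, h3.le⟩

/-- key weighted estimate -/
lemma west {γ : ℝ} (hγ : 0 < γ) {l : ℝ} (hl : 0 < l) {t : ℝ} (ht : 0 ≤ t) {g : ℝ → ℝ} {M : ℝ}
    (hM : 0 ≤ M) (hg : ∀ s ∈ Icc 0 t, |g s| ≤ M * Real.exp (l * s)) :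
    Real.exp (-(l * t)) * |∫ s in (0:ℝ)..t, (t - s) ^ (γ - 1) * g s| ≤
      M * ((1 / l) ^ γ * Real.Gamma γ) := by
  have hi : IntervalIntegrable (fun s => (t - s) ^ (γ - 1) * (M * Real.exp (l * s)))
      volume 0 t := kgint hγ t 0 t (by fun_prop)
  have h1 : |∫ s in (0:ℝ)..t, (t - s) ^ (γ - 1) * g s| ≤
      ∫ s in (0:ℝ)..t, (t - s) ^ (γ - 1) * (M * Real.exp (l * s)) := by
    rw [← Real.norm_eq_abs]
    refine intervalIntegral.norm_integral_le_of_norm_le ht ?_ hi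
    filter_upwards with s hs
    have h0 : 0 ≤ (t - s) ^ (γ - 1) := Real.rpow_nonneg (by linarith [hs.2]) _
    rw [Real.norm_eq_abs, abs_mul, abs_of_nonneg h0]
    exact mul_le_mul_of_nonneg_left (hg s ⟨hs.1.le, hs.2⟩) h0
  have h2 : Real.exp (-(l * t)) * ∫ s in (0:ℝ)..t, (t - s) ^ (γ - 1) * (M * Real.exp (l * s))
      = M * ∫ s in (0:ℝ)..t, (t - s) ^ (γ - 1) * Real.exp (-(l * (t - s))) := by
    rw [← intervalIntegral.integral_const_mul, ← intervalIntegral.integral_const_mul]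
    congr 1
    ext s
    have : Real.exp (-(l * (t - s))) = Real.exp (-(l * t)) * Real.exp (l * s) := by
      rw [← Real.exp_add]; ring_nf
    rw [this]; ring
  calc _ ≤ _ := mul_le_mul_of_nonneg_left h1 (Real.exp_pos _).le
    _ = _ := h2
    _ ≤ _ := mul_le_mul_of_nonneg_left (kexp hγ hl ht) hM

lemma uniq {γ : ℝ} (hγ : 0 < γ) (c u₀ : ℝ) {G : ℝ → ℝ} {K : NNReal} (hG : LipschitzWith K G)
    {u v : ℝ → ℝ} {T : ℝ} (hT : 0 ≤ T) (hu : ContinuousOn u (Icc 0 T))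
    (hv : ContinuousOn v (Icc 0 T))
    (hue : ∀ t ∈ Icc 0 T, u t = u₀ + c * ∫ s in (0:ℝ)..t, (t - s) ^ (γ - 1) * G (u s))
    (hve : ∀ t ∈ Icc 0 T, v t = u₀ + c * ∫ s in (0:ℝ)..t, (t - s) ^ (γ - 1) * G (v s)) :
    ∀ t ∈ Icc 0 T, u t = v t := by
  obtain ⟨l, hl, hl2⟩ := exl hγ (|c| * K)
  have hcont : ContinuousOn (fun t => Real.exp (-(l * t)) * |u t - v t|) (Icc 0 T) := by
    fun_prop
  obtain ⟨t, ht, hmax⟩ := isCompact_Icc.exists_isMaxOn ⟨0, left_mem_Icc.2 hT⟩ hcont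
  set M := Real.exp (-(l * t)) * |u t - v t| with hM
  have hM0 : 0 ≤ M := by positivity
  have hb : ∀ s ∈ Icc 0 T, |u s - v s| ≤ M * Real.exp (l * s) := by
    intro s hs
    have h1 : Real.exp (-(l * s)) * |u s - v s| ≤ M := hmax hs
    have h2 : Real.exp (-(l * s)) * Real.exp (l * s) = 1 := by
      rw [← Real.exp_add]; simp
    calc |u s - v s| = (Real.exp (-(l * s)) * |u s - v s|) * Real.exp (l * s) := by
          linear_combination (-|u s - v s|) * h2
      _ ≤ _ := mul_le_mul_of_nonneg_right h1 (Real.exp_pos _).le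
  have hsub : uIcc 0 t ⊆ Icc 0 T := by
    rw [uIcc_of_le ht.1]; exact Icc_subset_Icc_right ht.2
  have hd : u t - v t = c * ∫ s in (0:ℝ)..t, (t - s) ^ (γ - 1) * (G (u s) - G (v s)) := by
    rw [hue t ht, hve t ht]
    simp only [mul_sub]
    rw [intervalIntegral.integral_sub]
    · ring
    · exact kgint hγ t 0 t (hG.continuous.comp_continuousOn (hu.mono hsub))
    · exact kgint hγ t 0 t (hG.continuous.comp_continuousOn (hv.mono hsub))
  have hw := west hγ hl ht.1 (g := fun s => G (u s) - G (v s)) (M := K * M) (by positivity) (by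
    intro s hs
    have h1 := hG.dist_le_mul (u s) (v s)
    rw [Real.dist_eq, Real.dist_eq] at h1
    have h2 := hb s ⟨hs.1, hs.2.trans ht.2⟩
    calc _ ≤ _ := h1
      _ ≤ K * (M * Real.exp (l * s)) := by gcongr
      _ = _ := by ring)
  have hMle : M ≤ M * (1 / 2) := by
    calc M = |c| * (Real.exp (-(l * t)) *
          |∫ s in (0:ℝ)..t, (t - s) ^ (γ - 1) * (G (u s) - G (v s))|) := by
          rw [hM, hd, abs_mul]; ring
      _ ≤ |c| * (K * M * ((1 / l) ^ γ * Real.Gamma γ)) := by gcongr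
      _ = M * (|c| * K * ((1 / l) ^ γ * Real.Gamma γ)) := by ring
      _ ≤ _ := by gcongr
  have hMz : M = 0 := by linarith
  intro s hs
  have := hb s hs
  rw [hMz, zero_mul] at this
  exact sub_eq_zero.1 (abs_eq_zero.1 (le_antisymm this (abs_nonneg _)))

lemma contI {γ : ℝ} (hγ : 0 < γ) {g : ℝ → ℝ} (hg : Continuous g) {M : ℝ} (hM : ∀ x, |g x| ≤ M) :
    Continuous (fun t => ∫ s in (0:ℝ)..(max t 0), (max t 0 - s) ^ (γ - 1) * g s) := by
  have h1 : Continuous (fun t : ℝ => ∫ x in (0:ℝ)..1, (1 - x) ^ (γ - 1) * g (t * x)) := by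
    apply intervalIntegral.continuous_of_dominated_interval
      (bound := fun x => (1 - x) ^ (γ - 1) * M)
    · intro t
      have h := kgint hγ 1 0 1 (g := fun x => g (t * x)) (by fun_prop)
      rw [uIoc_of_le zero_le_one]
      exact h.1.aestronglyMeasurable
    · intro t
      filter_upwards with x hx
      rw [uIoc_of_le zero_le_one] at hx
      have h0 : 0 ≤ (1 - x) ^ (γ - 1) := Real.rpow_nonneg (by linarith [hx.2]) _
      rw [Real.norm_eq_abs, abs_mul, abs_of_nonneg h0]
      exact mul_le_mul_of_nonneg_left (hM _) h0
    · exact kgint hγ 1 0 1 (by fun_prop)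
    · filter_upwards with x hx
      fun_prop
  have h2 : ∀ t : ℝ, 0 ≤ t → ∫ s in (0:ℝ)..t, (t - s) ^ (γ - 1) * g s =
      t ^ γ * ∫ x in (0:ℝ)..1, (1 - x) ^ (γ - 1) * g (t * x) := by
    intro t ht
    rcases ht.eq_or_lt with rfl | ht
    · simp [Real.zero_rpow hγ.ne']
    · have := intervalIntegral.smul_integral_comp_mul_left (a := 0) (b := 1)
        (fun s => (t - s) ^ (γ - 1) * g s) t
      rw [mul_zero, mul_one] at this
      rw [← this, smul_eq_mul, ← intervalIntegral.integral_const_mul,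
        ← intervalIntegral.integral_const_mul]
      apply intervalIntegral.integral_congr
      intro x hx
      rw [uIcc_of_le zero_le_one] at hx
      have e1 : t - t * x = t * (1 - x) := by ring
      have e2 : t ^ γ = t * t ^ (γ - 1) := by
        rw [Real.rpow_sub_one ht.ne']; field_simp
      simp only
      rw [e1, Real.mul_rpow ht.le (by linarith [hx.2]), e2]
      ring
  have h3 : (fun t => ∫ s in (0:ℝ)..(max t 0), (max t 0 - s) ^ (γ - 1) * g s) =
      (fun t => t ^ γ * ∫ x in (0:ℝ)..1, (1 - x) ^ (γ - 1) * g (t * x)) ∘ (fun t => max t 0) := by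
    ext t
    exact h2 _ (le_max_right _ _)
  rw [h3]
  exact ((Real.continuous_rpow_const hγ.le).mul h1).comp (by fun_prop)

lemma exist {γ : ℝ} (hγ : 0 < γ) (c u₀ : ℝ) {G : ℝ → ℝ} {K : NNReal} (hG : LipschitzWith K G)
    {M : ℝ} (hM : ∀ x, |G x| ≤ M) :
    ∃ u : ℝ → ℝ, Continuous u ∧
      ∀ t, 0 ≤ t → u t = u₀ + c * ∫ s in (0:ℝ)..t, (t - s) ^ (γ - 1) * G (u s) := by
  obtain ⟨l, hl, hl2⟩ := exl hγ (|c| * K)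
  have hM0 : 0 ≤ M := (abs_nonneg _).trans (hM 0)
  let φ : (ℝ → ℝ) → ℝ → ℝ := fun w t => Real.exp (-(l * max t 0)) *
    (u₀ + c * ∫ s in (0:ℝ)..(max t 0), (max t 0 - s) ^ (γ - 1) * G (Real.exp (l * s) * w s))
  have hφc : ∀ w : ℝ → ℝ, Continuous w → Continuous (φ w) := by
    intro w hw
    have hgc : Continuous (fun s => G (Real.exp (l * s) * w s)) :=
      hG.continuous.comp (by fun_prop)
    have := contI hγ hgc (fun x => hM _)
    have h2 : Continuous (fun t : ℝ => Real.exp (-(l * max t 0))) := by fun_prop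
    exact h2.mul (continuous_const.add (continuous_const.mul this))
  have hφb : ∀ (w : ℝ → ℝ) t, ‖φ w t‖ ≤ |u₀| + |c| * (M * ((1 / l) ^ γ * Real.Gamma γ)) := by
    intro w t
    have ht : 0 ≤ max t 0 := le_max_right _ _
    have h1 := west hγ hl ht (g := fun s => G (Real.exp (l * s) * w s)) hM0 (by
      intro s hs
      have : 1 ≤ Real.exp (l * s) := Real.one_le_exp (mul_nonneg hl.le hs.1)
      exact (hM _).trans (le_mul_of_one_le_right hM0 this))
    have h2 : Real.exp (-(l * max t 0)) ≤ 1 := Real.exp_le_one_iff.2 (by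
      have := mul_nonneg hl.le ht; linarith)
    have h3 := Real.exp_pos (-(l * max t 0))
    simp only [φ, Real.norm_eq_abs]
    rw [abs_mul, abs_of_pos h3]
    set I := ∫ s in (0:ℝ)..(max t 0), (max t 0 - s) ^ (γ - 1) * G (Real.exp (l * s) * w s)
    calc _ ≤ Real.exp (-(l * max t 0)) * (|u₀| + |c| * |I|) := by
          gcongr
          rw [← abs_mul]; exact abs_add_le _ _
      _ = Real.exp (-(l * max t 0)) * |u₀| + |c| * (Real.exp (-(l * max t 0)) * |I|) := by ring
      _ ≤ 1 * |u₀| + |c| * (M * ((1 / l) ^ γ * Real.Gamma γ)) := by gcongr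
      _ = _ := by ring
  let Φ : BoundedContinuousFunction ℝ ℝ → BoundedContinuousFunction ℝ ℝ := fun w =>
    BoundedContinuousFunction.ofNormedAddCommGroup (φ w) (hφc w w.continuous) _ (hφb w)
  have hΦ : ContractingWith (1/2) Φ := by
    refine ⟨by rw [← NNReal.coe_lt_coe]; norm_num, LipschitzWith.of_dist_le_mul ?_⟩
    intro w₁ w₂
    rw [BoundedContinuousFunction.dist_le (by positivity)]
    intro t
    have ht : 0 ≤ max t 0 := le_max_right _ _
    have h1 := west hγ hl ht
      (g := fun s => G (Real.exp (l * s) * w₁ s) - G (Real.exp (l * s) * w₂ s))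
      (M := K * dist w₁ w₂) (by positivity) (by
      intro s hs
      have h1 := hG.dist_le_mul (Real.exp (l * s) * w₁ s) (Real.exp (l * s) * w₂ s)
      rw [Real.dist_eq, Real.dist_eq, ← mul_sub, abs_mul, abs_of_pos (Real.exp_pos _)] at h1
      have h2 := BoundedContinuousFunction.dist_coe_le_dist (f := w₁) (g := w₂) s
      rw [Real.dist_eq] at h2
      calc _ ≤ _ := h1
        _ ≤ K * (Real.exp (l * s) * dist w₁ w₂) := by gcongr
        _ = _ := by ring)
    have hi : ∀ w : BoundedContinuousFunction ℝ ℝ, IntervalIntegrable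
        (fun s => (max t 0 - s) ^ (γ - 1) * G (Real.exp (l * s) * w s)) volume 0 (max t 0) := by
      intro w
      apply kgint hγ
      have hw := w.continuous
      exact (hG.continuous.comp (by fun_prop)).continuousOn
    simp only [mul_sub] at h1
    rw [intervalIntegral.integral_sub (hi w₁) (hi w₂)] at h1
    simp only [Φ, BoundedContinuousFunction.coe_ofNormedAddCommGroup, φ]
    rw [Real.dist_eq]
    set I₁ := ∫ s in (0:ℝ)..(max t 0), (max t 0 - s) ^ (γ - 1) * G (Real.exp (l * s) * w₁ s)
    set I₂ := ∫ s in (0:ℝ)..(max t 0), (max t 0 - s) ^ (γ - 1) * G (Real.exp (l * s) * w₂ s)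
    calc _ = |c| * (Real.exp (-(l * max t 0)) * |I₁ - I₂|) := by
          rw [← mul_sub, abs_mul, abs_of_pos (Real.exp_pos _), add_sub_add_left_eq_sub,
            ← mul_sub, abs_mul]
          ring
      _ ≤ |c| * (K * dist w₁ w₂ * ((1 / l) ^ γ * Real.Gamma γ)) := by gcongr
      _ = (|c| * K * ((1 / l) ^ γ * Real.Gamma γ)) * dist w₁ w₂ := by ring
      _ ≤ _ := by
        have : (((1/2 : NNReal)) : ℝ) = 1/2 := by norm_num
        rw [this]; gcongr
  let w := hΦ.fixedPoint
  have hw : Φ w = w := hΦ.fixedPoint_isFixedPt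
  refine ⟨fun t => Real.exp (l * t) * w t, ?_, ?_⟩
  · have := w.continuous
    fun_prop
  · intro t ht
    have h1 : w t = φ w t := by
      conv_lhs => rw [← hw]
      rfl
    simp only [φ, max_eq_left ht] at h1
    beta_reduce
    conv_lhs => rw [h1]
    rw [← mul_assoc, ← Real.exp_add]
    simp

lemma mono_aux {γ : ℝ} (hγ : 0 < γ) (hγ1 : γ < 1) {c u₀ : ℝ} (hc : 0 < c) {G : ℝ → ℝ}
    {K : NNReal} (hG : LipschitzWith K G) (hpos : ∀ x, 0 < G x)
    (hmon : Monotone G ∨ Antitone G) {u : ℝ → ℝ} (hu : Continuous u)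
    (hue : ∀ t, 0 ≤ t → u t = u₀ - c * ∫ s in (0:ℝ)..t, (t - s) ^ (γ - 1) * G (u s))
    {h : ℝ} (hh : 0 < h) : ∀ t, 0 ≤ t → u (t + h) < u t := by
  have hGc := hG.continuous
  set g : ℝ → ℝ := fun s => G (u s) - G (u (s + h)) with hg
  have hgc : Continuous g := by fun_prop
  set v : ℝ → ℝ := fun t => u t - u (t + h) with hv
  have hvc : Continuous v := by fun_prop
  set ψ : ℝ → ℝ := fun t => ∫ s in (0:ℝ)..h, (t + h - s) ^ (γ - 1) * G (u s) with hψ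
  have hGu : ∀ t a b, IntervalIntegrable (fun s => (t - s) ^ (γ - 1) * G (u s)) volume a b :=
    fun t a b => kgint hγ t a b (by fun_prop)
  have hgi : ∀ t a b, IntervalIntegrable (fun s => (t - s) ^ (γ - 1) * g s) volume a b :=
    fun t a b => kgint hγ t a b (by fun_prop)
  have hveq : ∀ t, 0 ≤ t → v t = c * ψ t - c * ∫ s in (0:ℝ)..t, (t - s) ^ (γ - 1) * g s := by
    intro t ht
    have h1 : ∫ s in (0:ℝ)..(t + h), (t + h - s) ^ (γ - 1) * G (u s) =
        ψ t + ∫ s in (0:ℝ)..t, (t - s) ^ (γ - 1) * G (u (s + h)) := by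
      rw [← intervalIntegral.integral_add_adjacent_intervals (hGu (t + h) 0 h)
        (hGu (t + h) h (t + h))]
      congr 1
      have := intervalIntegral.integral_comp_add_right (a := 0) (b := t)
        (fun s => (t + h - s) ^ (γ - 1) * G (u s)) h
      rw [zero_add] at this
      rw [← this]
      congr 1
      ext s
      congr 2
      ring
    have h2 : ∫ s in (0:ℝ)..t, (t - s) ^ (γ - 1) * g s =
        (∫ s in (0:ℝ)..t, (t - s) ^ (γ - 1) * G (u s)) -
        ∫ s in (0:ℝ)..t, (t - s) ^ (γ - 1) * G (u (s + h)) := by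
      rw [← intervalIntegral.integral_sub (hGu t 0 t) (kgint hγ t 0 t (by fun_prop))]
      simp only [hg, mul_sub]
    simp only [hv]
    rw [hue t ht, hue (t + h) (by linarith), h1, h2]
    ring
  have hψpos : ∀ t, 0 ≤ t → 0 < ψ t := by
    intro t ht
    apply intervalIntegral.intervalIntegral_pos_of_pos_on (hGu (t + h) 0 h) _ hh
    intro s hs
    exact mul_pos (Real.rpow_pos_of_pos (by linarith [hs.2]) _) (hpos _)
  by_contra! hcon
  set S : Set ℝ := {t | 0 ≤ t ∧ v t ≤ 0} with hS
  have hSc : IsClosed S := (isClosed_Ici (a := (0:ℝ))).inter (isClosed_le hvc continuous_const)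
  have hSne : S.Nonempty := by
    obtain ⟨t, ht, ht2⟩ := hcon
    exact ⟨t, ht, by simp only [hv]; linarith⟩
  have hSb : BddBelow S := ⟨0, fun t ht => ht.1⟩
  set t₁ := sInf S with ht₁
  have hmem : t₁ ∈ S := hSc.csInf_mem hSne hSb
  have hlt : ∀ t, 0 ≤ t → t < t₁ → 0 < v t := by
    intro t ht htt
    by_contra! hc2
    exact absurd (csInf_le hSb (show t ∈ S from ⟨ht, hc2⟩)) (not_le.2 htt)
  have ht₁pos : 0 < t₁ := by
    rcases hmem.1.eq_or_lt with h0 | h0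
    · have h1 := hveq 0 le_rfl
      have h2 := hmem.2
      rw [← h0, h1, intervalIntegral.integral_same] at h2
      have := mul_pos hc (hψpos 0 le_rfl)
      linarith
    · exact h0
  rcases hmon with hmon | hmon
  · -- monotone case
    have hg0 : ∀ s, 0 ≤ s → s < t₁ → 0 ≤ g s ∧ g s ≤ K * v s := by
      intro s hs hs1
      have h1 := hlt s hs hs1
      have h2 : u (s + h) ≤ u s := by simp only [hv] at h1; linarith
      have h3 := hmon h2
      refine ⟨by simp only [hg]; linarith, ?_⟩
      have h4 := hG.dist_le_mul (u s) (u (s + h))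
      rw [Real.dist_eq, Real.dist_eq, abs_of_pos h1] at h4
      exact (le_abs_self _).trans h4
    obtain ⟨ε, hε, hε1, hε2⟩ : ∃ ε : ℝ, 0 < ε ∧ ε ≤ t₁ / 2 ∧ c * K * (ε ^ γ / γ) < 1 / 2 := by
      have h1 : Tendsto (fun ε : ℝ => c * K * (ε ^ γ / γ)) (𝓝[>] 0)
          (𝓝 (c * K * ((0:ℝ) ^ γ / γ))) := by
        apply Tendsto.mono_left _ nhdsWithin_le_nhds
        have : Continuous (fun ε : ℝ => c * K * (ε ^ γ / γ)) :=
          continuous_const.mul ((Real.continuous_rpow_const hγ.le).div_const _)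
        exact this.tendsto 0
      rw [Real.zero_rpow hγ.ne', zero_div, mul_zero] at h1
      have h2 := h1.eventually_lt_const (show (0:ℝ) < 1 / 2 by norm_num)
      have h3 : ∀ᶠ ε : ℝ in 𝓝[>] 0, ε < t₁ / 2 :=
        nhdsWithin_le_nhds (gt_mem_nhds (by linarith))
      obtain ⟨ε, ⟨h4, h5⟩, h6⟩ := ((h2.and h3).and self_mem_nhdsWithin).exists
      exact ⟨ε, h6, h5.le, h4⟩
    obtain ⟨t₂, ht₂, hmax⟩ := (isCompact_Icc (a := t₁ - ε) (b := t₁)).exists_isMaxOn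
      ⟨t₁ - ε, left_mem_Icc.2 (by linarith)⟩ hvc.continuousOn
    have hv2 : 0 < v t₂ := by
      have h1 : v (t₁ - ε) ≤ v t₂ := hmax (left_mem_Icc.2 (by linarith))
      have h2 := hlt (t₁ - ε) (by linarith) (by linarith)
      linarith
    have ht21 : t₂ < t₁ := by
      rcases ht₂.2.eq_or_lt with h0 | h0
      · rw [h0] at hv2; linarith [hmem.2]
      · exact h0
    have ht2pos : 0 < t₂ := by linarith [ht₂.1]
    set ρ := (t₁ / t₂) ^ (γ - 1) with hρ
    have hρ0 : 0 < ρ := Real.rpow_pos_of_pos (by positivity) _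
    have hρ2 : 1 / 2 ≤ ρ := by
      have h1 : (2:ℝ) ^ (γ - 1) ≤ ρ := by
        apply Real.rpow_le_rpow_of_nonpos (by positivity) _ (by linarith)
        rw [div_le_iff₀ ht2pos]; linarith [ht₂.1]
      have h2 : (2:ℝ) ^ (-1:ℝ) ≤ (2:ℝ) ^ (γ - 1) :=
        Real.rpow_le_rpow_of_exponent_le (by norm_num) (by linarith)
      rw [Real.rpow_neg_one] at h2
      linarith
    have hψ2 : ρ * ψ t₂ ≤ ψ t₁ := by
      simp only [hψ]
      rw [← intervalIntegral.integral_const_mul]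
      apply intervalIntegral.integral_mono_on_of_le_Ioo hh.le ((hGu _ _ _).const_mul _) (hGu _ _ _)
      intro s hs
      have hb : 0 < h - s := by linarith [hs.2]
      rw [← mul_assoc, hρ, ← Real.mul_rpow (by positivity) (by linarith)]
      apply mul_le_mul_of_nonneg_right _ (hpos _).le
      apply Real.rpow_le_rpow_of_nonpos (by linarith) _ (by linarith)
      rw [div_mul_eq_mul_div, le_div_iff₀ ht2pos]
      nlinarith
    have hI1 : ∫ s in (0:ℝ)..t₂, (t₁ - s) ^ (γ - 1) * g s ≤
        ρ * ∫ s in (0:ℝ)..t₂, (t₂ - s) ^ (γ - 1) * g s := by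
      rw [← intervalIntegral.integral_const_mul]
      apply intervalIntegral.integral_mono_on_of_le_Ioo ht2pos.le (hgi _ _ _)
        ((hgi _ _ _).const_mul _)
      intro s hs
      have hb : 0 < t₂ - s := by linarith [hs.2]
      rw [← mul_assoc, hρ, ← Real.mul_rpow (by positivity) (by linarith)]
      apply mul_le_mul_of_nonneg_right _ (hg0 s hs.1.le (by linarith)).1
      apply Real.rpow_le_rpow_of_nonpos (by positivity) _ (by linarith)
      rw [div_mul_eq_mul_div, div_le_iff₀ ht2pos]
      nlinarith [hs.1]
    have hI2 : ∫ s in t₂..t₁, (t₁ - s) ^ (γ - 1) * g s ≤ (ε ^ γ / γ) * (K * v t₂) := by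
      have h1 : ∫ s in t₂..t₁, (t₁ - s) ^ (γ - 1) * g s ≤
          ∫ s in t₂..t₁, (t₁ - s) ^ (γ - 1) * (K * v t₂) := by
        apply intervalIntegral.integral_mono_on_of_le_Ioo ht21.le (hgi _ _ _)
          ((kint hγ _ _ _).mul_const _)
        intro s hs
        apply mul_le_mul_of_nonneg_left _ (Real.rpow_nonneg (by linarith [hs.2]) _)
        have h2 := (hg0 s (by linarith [hs.1]) hs.2).2
        have h3 : v s ≤ v t₂ := hmax ⟨by linarith [hs.1, ht₂.1], hs.2.le⟩
        exact h2.trans (mul_le_mul_of_nonneg_left h3 K.coe_nonneg)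
      rw [intervalIntegral.integral_mul_const, kval hγ] at h1
      refine h1.trans ?_
      apply mul_le_mul_of_nonneg_right _ (mul_nonneg K.coe_nonneg hv2.le)
      apply div_le_div_of_nonneg_right _ hγ.le
      exact Real.rpow_le_rpow (by linarith) (by linarith [ht₂.1]) hγ.le
    have e1 := hveq t₁ hmem.1
    have e2 := hveq t₂ ht2pos.le
    rw [← intervalIntegral.integral_add_adjacent_intervals (hgi t₁ 0 t₂) (hgi t₁ t₂ t₁)] at e1
    set J1 := ∫ s in (0:ℝ)..t₂, (t₁ - s) ^ (γ - 1) * g s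
    set J2 := ∫ s in t₂..t₁, (t₁ - s) ^ (γ - 1) * g s
    set J3 := ∫ s in (0:ℝ)..t₂, (t₂ - s) ^ (γ - 1) * g s
    have f1 : c * (ρ * ψ t₂) ≤ c * ψ t₁ := mul_le_mul_of_nonneg_left hψ2 hc.le
    have f2 : c * J1 ≤ c * (ρ * J3) := mul_le_mul_of_nonneg_left hI1 hc.le
    have f3 : c * J2 ≤ c * ((ε ^ γ / γ) * (K * v t₂)) := mul_le_mul_of_nonneg_left hI2 hc.le
    have f4 : c * K * (ε ^ γ / γ) * v t₂ < 1 / 2 * v t₂ := mul_lt_mul_of_pos_right hε2 hv2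
    have f5 : 1 / 2 * v t₂ ≤ ρ * v t₂ := mul_le_mul_of_nonneg_right hρ2 hv2.le
    have f6 : ρ * v t₂ = c * (ρ * ψ t₂) - c * (ρ * J3) := by rw [e2]; ring
    have f7 : c * ((ε ^ γ / γ) * (K * v t₂)) = c * K * (ε ^ γ / γ) * v t₂ := by ring
    have f8 := hmem.2
    rw [e1] at f8
    linarith
  · have h1 : ∫ s in (0:ℝ)..t₁, (t₁ - s) ^ (γ - 1) * g s ≤ ∫ s in (0:ℝ)..t₁, (0:ℝ) := by
      apply intervalIntegral.integral_mono_on_of_le_Ioo hmem.1 (hgi _ _ _) (by simp)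
      intro s hs
      apply mul_nonpos_of_nonneg_of_nonpos (Real.rpow_nonneg (by linarith [hs.2]) _)
      have h2 := hlt s hs.1.le hs.2
      have h3 : u (s + h) ≤ u s := by simp only [hv] at h2; linarith
      have := hmon h3
      simp only [hg]; linarith
    rw [intervalIntegral.integral_zero] at h1
    have h2 := hveq t₁ hmem.1
    have h3 := mul_pos hc (hψpos t₁ hmem.1)
    have h4 := mul_nonpos_of_nonneg_of_nonpos hc.le h1
    linarith [hmem.2]

/-- truncated nonlinearity -/
noncomputable def clampG (p A u₀ δ : ℝ) : ℝ → ℝ := fun x => A * (max δ (min x u₀)) ^ p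

lemma clampG_lip (p A : ℝ) {u₀ δ : ℝ} (hδ : 0 < δ) (hδu : δ < u₀) :
    ∃ K, LipschitzWith K (clampG p A u₀ δ) := by
  have h1 : ContDiffOn ℝ 1 (fun x : ℝ => A * x ^ p) (Icc δ u₀) := by
    apply ContDiffOn.mul contDiffOn_const
    intro x hx
    exact (Real.contDiffAt_rpow_const_of_ne (by linarith [hx.1])).contDiffWithinAt
  obtain ⟨K, hK⟩ := h1.exists_lipschitzOnWith one_ne_zero (convex_Icc _ _) isCompact_Icc
  refine ⟨K, LipschitzWith.of_dist_le_mul fun x y => ?_⟩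
  have hm : ∀ x, max δ (min x u₀) ∈ Icc δ u₀ := fun x =>
    ⟨le_max_left _ _, max_le hδu.le (min_le_right _ _)⟩
  have h2 := hK.dist_le_mul _ (hm x) _ (hm y)
  have h3 := ((LipschitzWith.id (α := ℝ)).min_const u₀).const_max δ |>.dist_le_mul x y
  simp only [id, NNReal.coe_one, one_mul] at h3
  exact h2.trans (mul_le_mul_of_nonneg_left h3 K.coe_nonneg)

lemma clampG_bd (p : ℝ) {A u₀ δ : ℝ} (hA : A < 0) (hδ : 0 < δ) (hδu : δ < u₀) :
    ∃ m M, 0 < m ∧ ∀ x, clampG p A u₀ δ x ≤ -m ∧ |clampG p A u₀ δ x| ≤ M := by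
  have h1 : ContinuousOn (fun x : ℝ => A * x ^ p) (Icc δ u₀) := by
    intro x hx
    exact (continuousAt_const.mul (Real.continuousAt_rpow_const x p
      (Or.inl (by linarith [hx.1])))).continuousWithinAt
  have hm : ∀ x, max δ (min x u₀) ∈ Icc δ u₀ := fun x =>
    ⟨le_max_left _ _, max_le hδu.le (min_le_right _ _)⟩
  obtain ⟨y, hy, hmax⟩ := isCompact_Icc.exists_isMaxOn ⟨δ, left_mem_Icc.2 hδu.le⟩ h1
  obtain ⟨M, hM⟩ := isCompact_Icc.exists_bound_of_continuousOn h1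
  refine ⟨-(A * y ^ p), M, ?_, fun x => ⟨?_, ?_⟩⟩
  · have : 0 < y ^ p := Real.rpow_pos_of_pos (by linarith [hy.1]) _
    nlinarith
  · rw [neg_neg]; exact hmax (hm x)
  · exact hM _ (hm x)

lemma clampG_mono (p : ℝ) {A u₀ δ : ℝ} (hA : A < 0) (hδ : 0 < δ) :
    Monotone (fun x => - clampG p A u₀ δ x) ∨ Antitone (fun x => - clampG p A u₀ δ x) := by
  have hcl : ∀ x y : ℝ, x ≤ y → max δ (min x u₀) ≤ max δ (min y u₀) := fun x y hxy =>
    max_le_max le_rfl (min_le_min hxy le_rfl)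
  have hp : ∀ x : ℝ, 0 < max δ (min x u₀) := fun x => hδ.trans_le (le_max_left _ _)
  rcases le_total 0 p with h | h
  · left
    intro x y hxy
    have := Real.rpow_le_rpow (hp x).le (hcl x y hxy) h
    simp only [clampG]
    nlinarith
  · right
    intro x y hxy
    have := Real.rpow_le_rpow_of_nonpos (hp x) (hcl x y hxy) h
    simp only [clampG]
    nlinarith

lemma sol_delta {γ : ℝ} (p : ℝ) {A u₀ δ : ℝ} (hγ : 0 < γ) (hγ1 : γ < 1) (hA : A < 0)
    (hδ : 0 < δ) (hδu : δ < u₀) :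
    ∃ u : ℝ → ℝ, Continuous u ∧
      (∀ t, 0 ≤ t → u t = u₀ + (1 / Real.Gamma γ) *
        ∫ s in (0:ℝ)..t, (t - s) ^ (γ - 1) * clampG p A u₀ δ (u s)) ∧
      StrictAntiOn u (Ici 0) ∧ (∃ t, 0 ≤ t ∧ u t ≤ 0) := by
  obtain ⟨K, hK⟩ := clampG_lip p A hδ hδu
  obtain ⟨m, M, hm, hmM⟩ := clampG_bd p hA hδ hδu
  have hΓ := Real.Gamma_pos_of_pos hγ
  obtain ⟨u, huc, hue⟩ := exist hγ (1 / Real.Gamma γ) u₀ hK (fun x => (hmM x).2)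
  refine ⟨u, huc, hue, ?_, ?_⟩
  · have hlip : LipschitzWith K (fun x => - clampG p A u₀ δ x) := hK.neg
    have := @mono_aux γ hγ hγ1 (1 / Real.Gamma γ) u₀ (by positivity) _ K hlip
      (fun x => by have := (hmM x).1; linarith) (clampG_mono p hA hδ) u huc
      (by
        intro t ht
        rw [hue t ht]
        simp only [mul_neg, intervalIntegral.integral_neg, sub_neg_eq_add])
    intro x hx y hy hxy
    have h2 := this (h := y - x) (by linarith) x hx
    rwa [add_sub_cancel] at h2
  · set t := (|u₀| * Real.Gamma γ * γ / m) ^ (1 / γ) with ht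
    have ht0 : 0 ≤ t := by positivity
    refine ⟨t, ht0, ?_⟩
    have htγ : t ^ γ = |u₀| * Real.Gamma γ * γ / m := by
      rw [ht, ← Real.rpow_mul (by positivity), one_div, inv_mul_cancel₀ hγ.ne', Real.rpow_one]
    have h1 : ∫ s in (0:ℝ)..t, (t - s) ^ (γ - 1) * clampG p A u₀ δ (u s) ≤
        ∫ s in (0:ℝ)..t, (t - s) ^ (γ - 1) * (-m) := by
      apply intervalIntegral.integral_mono_on_of_le_Ioo ht0
        (kgint hγ _ _ _ (hK.continuous.comp huc).continuousOn) ((kint hγ _ _ _).mul_const _)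
      intro s hs
      exact mul_le_mul_of_nonneg_left (hmM _).1 (Real.rpow_nonneg (by linarith [hs.2]) _)
    rw [intervalIntegral.integral_mul_const, kval hγ, sub_zero, htγ] at h1
    have h2 : |u₀| * Real.Gamma γ * γ / m / γ * -m = - (|u₀| * Real.Gamma γ) := by
      field_simp
    rw [h2] at h1
    have h3 : (1 / Real.Gamma γ) * ∫ s in (0:ℝ)..t, (t - s) ^ (γ - 1) * clampG p A u₀ δ (u s) ≤
        (1 / Real.Gamma γ) * (- (|u₀| * Real.Gamma γ)) :=
      mul_le_mul_of_nonneg_left h1 (by positivity)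
    have h4 : (1 / Real.Gamma γ) * (- (|u₀| * Real.Gamma γ)) = -|u₀| := by field_simp
    rw [hue t ht0]
    linarith [le_abs_self u₀]

lemma clampG_eq (p A : ℝ) {u₀ δ x : ℝ} (h1 : δ ≤ x) (h2 : x ≤ u₀) :
    clampG p A u₀ δ x = A * x ^ p := by
  simp only [clampG, min_eq_left h2, max_eq_right h1]

lemma agree {γ : ℝ} (p : ℝ) {A u₀ δ : ℝ} (hγ : 0 < γ)
    (hδ : 0 < δ) (hδu : δ < u₀) {u v : ℝ → ℝ} (hu : Continuous u)
    (hue : ∀ t, 0 ≤ t → u t = u₀ + (1 / Real.Gamma γ) *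
        ∫ s in (0:ℝ)..t, (t - s) ^ (γ - 1) * clampG p A u₀ δ (u s))
    {T : ℝ} (hT : 0 ≤ T) (hv : ContinuousOn v (Icc 0 T))
    (hvr : ∀ t ∈ Icc 0 T, δ ≤ v t ∧ v t ≤ u₀)
    (hve : ∀ t ∈ Icc 0 T, v t = u₀ + (1 / Real.Gamma γ) *
        ∫ s in (0:ℝ)..t, (t - s) ^ (γ - 1) * (A * v s ^ p)) :
    ∀ t ∈ Icc 0 T, v t = u t := by
  obtain ⟨K, hK⟩ := clampG_lip p A hδ hδu
  refine uniq hγ (1 / Real.Gamma γ) u₀ hK hT hv hu.continuousOn ?_ (fun t ht => hue t ht.1)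
  intro t ht
  rw [hve t ht]
  congr 2
  apply intervalIntegral.integral_congr
  intro s hs
  rw [uIcc_of_le ht.1] at hs
  have := hvr s ⟨hs.1, hs.2.trans ht.2⟩
  simp only [clampG_eq p A this.1 this.2]

/-- `A < 0`: existence of a unique positive decreasing solution
tending to `0` at the maximal time. -/
theorem stmt15 (γ p A u₀ : ℝ)
    (hγ : γ ∈ Set.Ioo (0:ℝ) 1) (hA : A < 0) (hu₀ : 0 < u₀) :
    0 < maxTime γ (fun x => A * x ^ p) (Set.Ioi 0) u₀ ∧
    ∃ u : ℝ → ℝ,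
      IsSolUpTo γ (fun x => A * x ^ p) (Set.Ioi 0) u₀ u
        (maxTime γ (fun x => A * x ^ p) (Set.Ioi 0) u₀) ∧
      (∀ (v : ℝ → ℝ) (T : ℝ≥0∞), IsSolUpTo γ (fun x => A * x ^ p) (Set.Ioi 0) u₀ v T →
        ∀ t : ℝ, 0 ≤ t →
          ENNReal.ofReal t < min T (maxTime γ (fun x => A * x ^ p) (Set.Ioi 0) u₀) →
          v t = u t) ∧
      (∀ t : ℝ, 0 < t → ENNReal.ofReal t < maxTime γ (fun x => A * x ^ p) (Set.Ioi 0) u₀ →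
        0 < u t ∧ u t < u₀) ∧
      StrictAntiOn u
        {t : ℝ | 0 ≤ t ∧ ENNReal.ofReal t < maxTime γ (fun x => A * x ^ p) (Set.Ioi 0) u₀} ∧
      (maxTime γ (fun x => A * x ^ p) (Set.Ioi 0) u₀ = ⊤ → Tendsto u atTop (𝓝 0)) ∧
      (maxTime γ (fun x => A * x ^ p) (Set.Ioi 0) u₀ ≠ ⊤ →
        Tendsto u (𝓝[<] (maxTime γ (fun x => A * x ^ p) (Set.Ioi 0) u₀).toReal) (𝓝 0)) := by
  have hγ0 := hγ.1
  have hΓ := Real.Gamma_pos_of_pos hγ0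
  choose! U hUc hUe hUa hU0 using fun (δ : ℝ) (h : δ ∈ Ioo 0 u₀) =>
    sol_delta (γ := γ) p hγ.1 hγ.2 hA h.1 h.2
  set Tb := maxTime γ (fun x => A * x ^ p) (Set.Ioi 0) u₀ with hTb
  have hUzero : ∀ δ ∈ Ioo 0 u₀, U δ 0 = u₀ := by
    intro δ hδ
    rw [hUe δ hδ 0 le_rfl]; simp
  have hUrange : ∀ δ ∈ Ioo 0 u₀, ∀ t, 0 ≤ t → δ < U δ t → ∀ s ∈ Icc 0 t,
      δ ≤ U δ s ∧ U δ s ≤ u₀ := by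
    intro δ hδ t ht h s hs
    have h1 := (hUa δ hδ).antitoneOn (show s ∈ Ici 0 from hs.1) (show t ∈ Ici 0 from ht) hs.2
    have h2 := (hUa δ hδ).antitoneOn (show (0:ℝ) ∈ Ici 0 from self_mem_Ici)
      (show s ∈ Ici 0 from hs.1) hs.1
    rw [hUzero δ hδ] at h2
    exact ⟨h.le.trans h1, h2⟩
  have hUtrue : ∀ δ ∈ Ioo 0 u₀, ∀ t, 0 ≤ t → δ < U δ t → ∀ s ∈ Icc 0 t,
      U δ s = u₀ + (1 / Real.Gamma γ) *
        ∫ r in (0:ℝ)..s, (s - r) ^ (γ - 1) * (A * U δ r ^ p) := by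
    intro δ hδ t ht h s hs
    rw [hUe δ hδ s hs.1]
    congr 2
    apply intervalIntegral.integral_congr
    intro r hr
    rw [uIcc_of_le hs.1] at hr
    have := hUrange δ hδ t ht h r ⟨hr.1, hr.2.trans hs.2⟩
    simp only [clampG_eq p A this.1 this.2]
  have hcons1 : ∀ δ₁ ∈ Ioo 0 u₀, ∀ δ₂ ∈ Ioo 0 u₀, δ₁ ≤ δ₂ → ∀ t, 0 ≤ t → δ₂ < U δ₂ t →
      U δ₂ t = U δ₁ t := by
    intro δ₁ h₁ δ₂ h₂ h12 t ht h
    refine agree p hγ0 h₁.1 h₁.2 (hUc δ₁ h₁) (hUe δ₁ h₁) ht (hUc δ₂ h₂).continuousOn ?_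
      (hUtrue δ₂ h₂ t ht h) t ⟨ht, le_rfl⟩
    intro s hs
    have := hUrange δ₂ h₂ t ht h s hs
    exact ⟨h12.trans this.1, this.2⟩
  have hcons : ∀ δ₁ ∈ Ioo 0 u₀, ∀ δ₂ ∈ Ioo 0 u₀, ∀ t, 0 ≤ t → δ₁ < U δ₁ t → δ₂ < U δ₂ t →
      U δ₁ t = U δ₂ t := by
    intro δ₁ h₁ δ₂ h₂ t ht g₁ g₂
    rcases le_total δ₁ δ₂ with h | h
    · exact (hcons1 δ₁ h₁ δ₂ h₂ h t ht g₂).symm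
    · exact hcons1 δ₂ h₂ δ₁ h₁ h t ht g₁
  have hnext : ∀ δ ∈ Ioo 0 u₀, ∀ t, δ < U δ t → ∃ t', t < t' ∧ δ < U δ t' := by
    intro δ hδ t h
    have h1 : ∀ᶠ s in 𝓝[>] t, δ < U δ s :=
      nhdsWithin_le_nhds ((hUc δ hδ).continuousAt.eventually (lt_mem_nhds h))
    obtain ⟨s, h2, h3⟩ := (h1.and self_mem_nhdsWithin).exists
    exact ⟨s, h3, h2⟩
  have hUsol : ∀ δ ∈ Ioo 0 u₀, ∀ t, 0 ≤ t → δ < U δ t →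
      IsSolUpTo γ (fun x => A * x ^ p) (Set.Ioi 0) u₀ (U δ) (ENNReal.ofReal t) := by
    intro δ hδ t ht h
    have hlt : ∀ s, ENNReal.ofReal s < ENNReal.ofReal t → s ≤ t := fun s hs =>
      (ENNReal.ofReal_lt_ofReal_iff'.1 hs).1.le
    refine ⟨hUzero δ hδ, (hUc δ hδ).continuousOn, ?_, ?_⟩
    · intro s hs hs2
      exact hδ.1.trans_le (hUrange δ hδ t ht h s ⟨hs, hlt s hs2⟩).1
    · intro s hs hs2
      exact hUtrue δ hδ t ht h s ⟨hs, hlt s hs2⟩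
  have hlift : ∀ (v : ℝ → ℝ) (T : ℝ≥0∞), IsSolUpTo γ (fun x => A * x ^ p) (Set.Ioi 0) u₀ v T →
      ∀ t, 0 ≤ t → ENNReal.ofReal t < T → ∃ δ ∈ Ioo 0 u₀, v t = U δ t ∧ δ < U δ t := by
    rintro v T ⟨hv0, hvc, hvp, hve⟩ t ht htT
    have hin : ∀ s ∈ Icc 0 t, ENNReal.ofReal s < T := fun s hs =>
      (ENNReal.ofReal_le_ofReal hs.2).trans_lt htT
    have hvc' : ContinuousOn v (Icc 0 t) := hvc.mono fun s hs => ⟨hs.1, hin s hs⟩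
    obtain ⟨y, hy, hmin⟩ := isCompact_Icc.exists_isMinOn ⟨0, left_mem_Icc.2 ht⟩ hvc'
    have hy0 : 0 < v y := hvp y hy.1 (hin y hy)
    have hyu : v y ≤ u₀ := by rw [← hv0]; exact hmin (left_mem_Icc.2 ht)
    have hle : ∀ s ∈ Icc 0 t, v s ≤ u₀ := by
      intro s hs
      rw [hve s hs.1 (hin s hs)]
      have h1 : ∫ r in (0:ℝ)..s, (s - r) ^ (γ - 1) * (A * v r ^ p) ≤ 0 := by
        rw [intervalIntegral.integral_of_le hs.1]
        apply setIntegral_nonpos measurableSet_Ioc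
        intro r hr
        apply mul_nonpos_of_nonneg_of_nonpos (Real.rpow_nonneg (by linarith [hr.2]) _)
        have h2 : 0 < v r := hvp r hr.1.le (hin r ⟨hr.1.le, hr.2.trans hs.2⟩)
        exact mul_nonpos_of_nonpos_of_nonneg hA.le (Real.rpow_nonneg h2.le _)
      have h3 := mul_nonpos_of_nonneg_of_nonpos (one_div_pos.2 hΓ).le h1
      simp only
      linarith
    have hδ : v y / 2 ∈ Ioo 0 u₀ := ⟨by linarith, by linarith⟩
    have hge : ∀ s ∈ Icc 0 t, v y ≤ v s := fun s hs => hmin hs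
    have hag := agree p hγ0 hδ.1 hδ.2 (hUc _ hδ) (hUe _ hδ) ht hvc'
      (fun s hs => ⟨by linarith [hge s hs], hle s hs⟩)
      (fun s hs => hve s hs.1 (hin s hs)) t ⟨ht, le_rfl⟩
    refine ⟨_, hδ, hag, ?_⟩
    rw [← hag]
    linarith [hge t ⟨ht, le_rfl⟩]
  have hQ : ∀ t, 0 ≤ t → (ENNReal.ofReal t < Tb ↔ ∃ δ ∈ Ioo 0 u₀, δ < U δ t) := by
    intro t ht
    constructor
    · intro h
      obtain ⟨T, ⟨v, hv⟩, hT⟩ := lt_sSup_iff.1 h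
      obtain ⟨δ, hδ, _, h2⟩ := hlift v T hv t ht hT
      exact ⟨δ, hδ, h2⟩
    · rintro ⟨δ, hδ, h⟩
      obtain ⟨t', h1, h2⟩ := hnext δ hδ t h
      have h3 : ENNReal.ofReal t' ≤ Tb :=
        le_sSup ⟨U δ, hUsol δ hδ t' (by linarith) h2⟩
      exact ((ENNReal.ofReal_lt_ofReal_iff (by linarith)).2 h1).trans_le h3
  classical
  let u : ℝ → ℝ := fun t => if h : ∃ δ ∈ Ioo 0 u₀, δ < U δ t then U h.choose t else 0
  have hP : ∀ δ ∈ Ioo 0 u₀, ∀ t, 0 ≤ t → δ < U δ t → ∀ s ∈ Icc 0 t, u s = U δ s := by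
    intro δ hδ t ht h s hs
    have h1 : δ < U δ s := h.trans_le
      ((hUa δ hδ).antitoneOn (show s ∈ Ici 0 from hs.1) (show t ∈ Ici 0 from ht) hs.2)
    have hex : ∃ δ ∈ Ioo 0 u₀, δ < U δ s := ⟨δ, hδ, h1⟩
    simp only [u, dif_pos hex]
    exact hcons _ hex.choose_spec.1 δ hδ s hs.1 hex.choose_spec.2 h1
  have hanti : StrictAntiOn u {t : ℝ | 0 ≤ t ∧ ENNReal.ofReal t < Tb} := by
    intro x hx y hy hxy
    obtain ⟨δ, hδ, h⟩ := (hQ y hy.1).1 hy.2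
    rw [hP δ hδ y hy.1 h x ⟨hx.1, hxy.le⟩, hP δ hδ y hy.1 h y ⟨hy.1, le_rfl⟩]
    exact hUa δ hδ hx.1 hy.1 hxy
  have hhalf : u₀ / 2 ∈ Ioo 0 u₀ := ⟨by linarith, by linarith⟩
  have hTb0 : ENNReal.ofReal 0 < Tb :=
    (hQ 0 le_rfl).2 ⟨_, hhalf, by rw [hUzero _ hhalf]; linarith⟩
  have hu0 : u 0 = u₀ := by
    rw [hP _ hhalf 0 le_rfl (by rw [hUzero _ hhalf]; linarith) 0 ⟨le_rfl, le_rfl⟩]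
    exact hUzero _ hhalf
  have hupos : ∀ t, 0 ≤ t → ENNReal.ofReal t < Tb → 0 < u t := by
    intro t ht h
    obtain ⟨δ, hδ, h⟩ := (hQ t ht).1 h
    rw [hP δ hδ t ht h t ⟨ht, le_rfl⟩]
    exact hδ.1.trans h
  have hsmall : ∀ ε, 0 < ε → ∃ t, 0 ≤ t ∧ ENNReal.ofReal t < Tb ∧ u t < ε := by
    intro ε hε
    set δ := min (u₀ / 2) (ε / 2) / 2 with hδd
    have hd1 : 0 < min (u₀ / 2) (ε / 2) := lt_min (by linarith) (by linarith)
    have hd2 := min_le_left (u₀ / 2) (ε / 2)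
    have hd3 := min_le_right (u₀ / 2) (ε / 2)
    have hδ : δ ∈ Ioo 0 u₀ := ⟨by linarith, by linarith⟩
    obtain ⟨t, ht, hut⟩ := hU0 δ hδ
    have hiv := intermediate_value_Icc' ht (hUc δ hδ).continuousOn
    obtain ⟨s, hs, hs2⟩ := hiv (show 2 * δ ∈ Icc (U δ t) (U δ 0) from
      ⟨by linarith [hδ.1], by rw [hUzero δ hδ]; linarith⟩)
    have hs3 : δ < U δ s := by rw [hs2]; linarith [hδ.1]
    refine ⟨s, hs.1, (hQ s hs.1).2 ⟨δ, hδ, hs3⟩, ?_⟩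
    rw [hP δ hδ s hs.1 hs3 s ⟨hs.1, le_rfl⟩, hs2]
    linarith
  refine ⟨by simpa using hTb0, u, ⟨hu0, ?_, fun t ht h => hupos t ht h, ?_⟩, ?_, ?_, hanti, ?_, ?_⟩
  · rintro t ⟨ht, h⟩
    obtain ⟨δ, hδ, h⟩ := (hQ t ht).1 h
    obtain ⟨t', h1, h2⟩ := hnext δ hδ t h
    have hP' := hP δ hδ t' (by linarith) h2
    apply (hUc δ hδ).continuousWithinAt.congr_of_eventuallyEq
    · have h3 : ∀ᶠ s in 𝓝[{t : ℝ | 0 ≤ t ∧ ENNReal.ofReal t < Tb}] t, s < t' :=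
        nhdsWithin_le_nhds (gt_mem_nhds h1)
      filter_upwards [h3, self_mem_nhdsWithin] with s hs hs2
      exact hP' s ⟨hs2.1, hs.le⟩
    · exact hP' t ⟨ht, h1.le⟩
  · intro t ht h
    obtain ⟨δ, hδ, h⟩ := (hQ t ht).1 h
    have hP' := hP δ hδ t ht h
    rw [hP' t ⟨ht, le_rfl⟩, hUtrue δ hδ t ht h t ⟨ht, le_rfl⟩]
    congr 2
    apply intervalIntegral.integral_congr
    intro r hr
    rw [uIcc_of_le ht] at hr
    simp only [hP' r hr]
  · intro v T hv t ht h
    obtain ⟨δ, hδ, h1, h2⟩ := hlift v T hv t ht (h.trans_le (min_le_left _ _))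
    rw [h1, hP δ hδ t ht h2 t ⟨ht, le_rfl⟩]
  · intro t ht h
    refine ⟨hupos t ht.le h, ?_⟩
    have := hanti (show (0:ℝ) ∈ {t : ℝ | 0 ≤ t ∧ ENNReal.ofReal t < Tb} from ⟨le_rfl, hTb0⟩)
      (show t ∈ _ from ⟨ht.le, h⟩) ht
    rwa [hu0] at this
  · intro htop
    rw [Metric.tendsto_nhds]
    intro ε hε
    obtain ⟨s, hs, hs2, hs3⟩ := hsmall ε hε
    filter_upwards [eventually_ge_atTop s] with t ht
    have htT : ENNReal.ofReal t < Tb := by rw [htop]; exact ENNReal.ofReal_lt_top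
    have h1 := hupos t (hs.trans ht) htT
    have h2 : u t ≤ u s := hanti.antitoneOn ⟨hs, hs2⟩ ⟨hs.trans ht, htT⟩ ht
    rw [Real.dist_eq, sub_zero, abs_of_pos h1]
    linarith
  · intro htop
    rw [Metric.tendsto_nhds]
    intro ε hε
    obtain ⟨s, hs, hs2, hs3⟩ := hsmall ε hε
    have hs4 : s < Tb.toReal := (ENNReal.ofReal_lt_iff_lt_toReal hs htop).1 hs2
    have h3 : ∀ᶠ t in 𝓝[<] Tb.toReal, s < t := nhdsWithin_le_nhds (lt_mem_nhds hs4)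
    filter_upwards [h3, self_mem_nhdsWithin] with t ht ht2
    have ht0 : 0 ≤ t := hs.trans ht.le
    have htT : ENNReal.ofReal t < Tb := (ENNReal.ofReal_lt_iff_lt_toReal ht0 htop).2 ht2
    have h1 := hupos t ht0 htT
    have h2 : u t ≤ u s := hanti.antitoneOn ⟨hs, hs2⟩ ⟨ht0, htT⟩ ht.le
    rw [Real.dist_eq, sub_zero, abs_of_pos h1]
    linarith
end
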